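/- arXiv:1703.03313 — 6 statements merged into one kernel-verified Lean document; each statement's English description precedes it below -/
import Mathlib

section
/- For any real numbers u, v with 0 < u < v, there exist real numbers a > 0, b > 0, c > 0, d > 0 such that the polynomial R(x) = x^8 + a x^7 + b x^6 + c x + d satisfies R(−u) = R′(−u) = R(−v) = R′(−v) = 0; consequently R(x) = (x+u)^2 (x+v)^2 S(x), where S is a monic real polynomial of degree 4 with no real roots. -/
open Polynomial

/-- The complete homogeneous symmetric polynomial of degree `k` evaluated at `(u, u, v, v)`. -/
noncomputable def doubledHomogeneous (u v : ℝ) (k : ℕ) : ℝ :=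
  ∑ i ∈ Finset.range (k + 1), ((i : ℝ) + 1) * ((k - i : ℕ) + 1) * u ^ i * v ^ (k - i)

theorem doubledHomogeneous_pos {u v : ℝ} (hu : 0 < u) (hv : 0 < v) (k : ℕ) :
    0 < doubledHomogeneous u v k :=
  Finset.sum_pos (fun _ _ => by positivity) Finset.nonempty_range_add_one

theorem doubledHomogeneous_minor_four_four {u v : ℝ} (hu : 0 < u) (hv : 0 < v) :
    0 < doubledHomogeneous u v 4 * doubledHomogeneous u v 4 -
      doubledHomogeneous u v 5 * doubledHomogeneous u v 3 := by
  norm_num [doubledHomogeneous, Finset.sum_range_succ, -sub_pos]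
  ring_nf
  positivity

theorem doubledHomogeneous_minor_five_four {u v : ℝ} (hu : 0 < u) (hv : 0 < v) :
    0 < doubledHomogeneous u v 5 * doubledHomogeneous u v 4 -
      doubledHomogeneous u v 6 * doubledHomogeneous u v 3 := by
  norm_num [doubledHomogeneous, Finset.sum_range_succ, -sub_pos]
  ring_nf
  positivity

theorem doubledHomogeneous_minor_five_five {u v : ℝ} (hu : 0 < u) (hv : 0 < v) :
    0 < doubledHomogeneous u v 5 * doubledHomogeneous u v 5 -
      doubledHomogeneous u v 6 * doubledHomogeneous u v 4 := by
  norm_num [doubledHomogeneous, Finset.sum_range_succ, -sub_pos]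
  ring_nf
  positivity

theorem doubledHomogeneous_minor_four_three {u v : ℝ} (hu : 0 < u) (hv : 0 < v) :
    0 < doubledHomogeneous u v 4 * doubledHomogeneous u v 3 -
      doubledHomogeneous u v 5 * doubledHomogeneous u v 2 := by
  norm_num [doubledHomogeneous, Finset.sum_range_succ, -sub_pos]
  ring_nf
  positivity

theorem doubledHomogeneous_minor_four_two {u v : ℝ} (hu : 0 < u) (hv : 0 < v) :
    0 < doubledHomogeneous u v 4 * doubledHomogeneous u v 2 -
      doubledHomogeneous u v 5 * doubledHomogeneous u v 1 := by
  norm_num [doubledHomogeneous, Finset.sum_range_succ, -sub_pos]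
  ring_nf
  positivity

theorem doubledHomogeneous_minor_four_one {u v : ℝ} (hu : 0 < u) (hv : 0 < v) :
    0 < doubledHomogeneous u v 4 * doubledHomogeneous u v 1 -
      doubledHomogeneous u v 5 * doubledHomogeneous u v 0 := by
  norm_num [doubledHomogeneous, Finset.sum_range_succ, -sub_pos]
  ring_nf
  positivity

/-- For any `0 < u < v` there is a polynomial `R = x^8 + a x^7 + b x^6 + c x + d`
with `a, b, c, d > 0` such that `R(-u) = R'(-u) = R(-v) = R'(-v) = 0`; hence
`R = (x+u)^2 (x+v)^2 S(x)` where `S` is monic of degree 4 with no real roots. -/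
theorem stmt6 (u v : ℝ) (hu : 0 < u) (huv : u < v) :
    ∃ a b c d : ℝ, 0 < a ∧ 0 < b ∧ 0 < c ∧ 0 < d ∧
      ∃ R : Polynomial ℝ,
        R = X ^ 8 + C a * X ^ 7 + C b * X ^ 6 + C c * X + C d ∧
        R.eval (-u) = 0 ∧ (derivative R).eval (-u) = 0 ∧
        R.eval (-v) = 0 ∧ (derivative R).eval (-v) = 0 ∧
        ∃ S : Polynomial ℝ, S.Monic ∧ S.degree = 4 ∧
          (∀ x : ℝ, S.eval x ≠ 0) ∧
          R = (X + C u) ^ 2 * (X + C v) ^ 2 * S := by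
  have hv : 0 < v := hu.trans huv
  let h := doubledHomogeneous u v
  let K := h 4 * h 4 - h 5 * h 3
  have hK : 0 < K := doubledHomogeneous_minor_four_four hu hv
  let a := (h 5 * h 4 - h 6 * h 3) / K
  let b := (h 5 * h 5 - h 6 * h 4) / K
  let c := (u * v) ^ 5 * h 5 / K
  let d := (u * v) ^ 6 * h 4 / K
  let p := (u * v) * (h 4 * h 3 - h 5 * h 2) / K
  let q := (u * v) ^ 2 * (h 4 * h 2 - h 5 * h 1) / K
  let r := (u * v) ^ 3 * (h 4 * h 1 - h 5 * h 0) / K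
  let t := (u * v) ^ 4 * h 4 / K
  have huw : 0 < u * v := mul_pos hu hv
  have h4 : 0 < h 4 := doubledHomogeneous_pos hu hv 4
  have h5 : 0 < h 5 := doubledHomogeneous_pos hu hv 5
  have ha : 0 < a := div_pos (doubledHomogeneous_minor_five_four hu hv) hK
  have hb : 0 < b := div_pos (doubledHomogeneous_minor_five_five hu hv) hK
  have hc : 0 < c := by positivity
  have hd : 0 < d := by positivity
  have hp : 0 < p :=
    div_pos (mul_pos huw (doubledHomogeneous_minor_four_three hu hv)) hK
  have hq : 0 < q :=
    div_pos (mul_pos (pow_pos huw 2) (doubledHomogeneous_minor_four_two hu hv)) hK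
  have hr : 0 < r :=
    div_pos (mul_pos (pow_pos huw 3) (doubledHomogeneous_minor_four_one hu hv)) hK
  have ht : 0 < t := by positivity
  have factor (x : ℝ) : x ^ 8 + a * x ^ 7 + b * x ^ 6 + c * x + d =
      (x + u) ^ 2 * (x + v) ^ 2 * (x ^ 4 - p * x ^ 3 + q * x ^ 2 - r * x + t) := by
    simp only [a, b, c, d, p, q, r, t]
    field_simp
    norm_num [K, h, doubledHomogeneous, Finset.sum_range_succ]
    ring
  let S : ℝ[X] := X ^ 4 - C p * X ^ 3 + C q * X ^ 2 - C r * X + C t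
  have hS : S.degree = 4 := by unfold S; compute_degree!
  have hR : X ^ 8 + C a * X ^ 7 + C b * X ^ 6 + C c * X + C d =
      (X + C u) ^ 2 * (X + C v) ^ 2 * S :=
    Polynomial.funext fun x => by simpa [S] using factor x
  refine ⟨a, b, c, d, ha, hb, hc, hd, _, rfl, ?_, ?_, ?_, ?_, S, ?_, hS, fun x hx => ?_, hR⟩
  · simp [hR]
  · simp [hR, derivative_pow]
  · simp [hR]
  · simp [hR, derivative_pow]
  · unfold S; monicity!
  · have hx' : x ^ 4 - p * x ^ 3 + q * x ^ 2 - r * x + t = 0 := by simpa [S] using hx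
    rcases le_total 0 x with h0 | h0
    · have hpos : 0 < x ^ 8 + a * x ^ 7 + b * x ^ 6 + c * x + d := by positivity
      rw [factor, hx', mul_zero] at hpos
      exact hpos.false
    · obtain ⟨y, rfl⟩ : ∃ y, x = -y := ⟨-x, (neg_neg x).symm⟩
      have hy : 0 ≤ y := neg_nonpos.mp h0
      have hpos : 0 < y ^ 4 + p * y ^ 3 + q * y ^ 2 + r * y + t := by positivity
      exact hpos.ne' (by linear_combination hx')
end

section
/- There is no monic real polynomial of degree 8 of the form (x−ν_1)^2 (x−ν_2)^2 (x−ν_3)^2 (x−δ)^2 with ν_1, ν_2, ν_3 < 0 and δ > 0 (three double negative roots and one double positive root) that defines the sign pattern (+,+,+,−,−,−,−,+,+). -/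
open Polynomial

/-- A degree-8 real polynomial `P` defines the sign pattern `σ = (σ_0, …, σ_8)`
(with entries `1` for `+`, `-1` for `−`) if for each `j` the coefficient of
`x^(8-j)` is nonzero and has sign `σ_j`. -/
def definesSignPattern (P : Polynomial ℝ) (σ : Fin 9 → ℝ) : Prop :=
  ∀ j : Fin 9, Real.sign (P.coeff (8 - (j : ℕ))) = σ j

/-- For positive `a, b, c`, the coefficients of `x ^ 5` and `x ^ 2` in
`((x + a) (x + b) (x + c) (x - 1)) ^ 2` are not both negative. -/
lemma not_coeff_five_neg_and_coeff_two_neg {a b c : ℝ} (ha : 0 < a) (hb : 0 < b) (hc : 0 < c)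
    (h5 : (a * b * c - (a * b + b * c + c * a))
      + (a + b + c - 1) * ((a * b + b * c + c * a) - (a + b + c)) < 0)
    (h2 : (a * b * c - (a * b + b * c + c * a)) ^ 2
      - 2 * ((a * b + b * c + c * a) - (a + b + c)) * (a * b * c) < 0) : False := by
  have hm : 0 < a + b + c := by positivity
  have hS : 0 < a * b * c := by positivity
  have newton₁ : 3 * (a * b + b * c + c * a) ≤ (a + b + c) ^ 2 := by
    nlinarith [sq_nonneg (a - b), sq_nonneg (b - c), sq_nonneg (c - a)]
  have newton₂ : 3 * (a + b + c) * (a * b * c) ≤ (a * b + b * c + c * a) ^ 2 := by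
    nlinarith [sq_nonneg (a * b - b * c), sq_nonneg (b * c - c * a), sq_nonneg (c * a - a * b)]
  obtain ⟨q, hq⟩ : ∃ q, a * b + b * c + c * a = a + b + c + q := ⟨_, (add_sub_cancel _ _).symm⟩
  rw [hq] at h5 h2 newton₁ newton₂
  generalize a + b + c = m at *
  generalize a * b * c = S at *
  have hq0 : 0 < q := by
    by_contra! h
    nlinarith [sq_nonneg (S - (m + q)), mul_nonneg (neg_nonneg.2 h) hS.le]
  have hm3 : 3 < m := by nlinarith
  obtain ⟨R, hR⟩ : ∃ R, S = m + q - R := ⟨m + q - S, by ring⟩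
  subst hR
  have hpq : (m - 1) * q < R := by linarith
  have hR2 : R ^ 2 < 2 * q * (m + q - R) := by linarith
  have hpq0 : 0 < (m - 1) * q := mul_pos (by linarith) hq0
  have hsq : ((m - 1) * q) ^ 2 < R ^ 2 := by gcongr
  have hS2 : (m - 1) ^ 2 * q < 2 * (m + q - R) := by
    refine lt_of_mul_lt_mul_left ?_ hq0.le
    linarith
  have hqm : 3 * q < m := by nlinarith [mul_pos (sub_pos.2 hm3) hq0]
  have hRm : 2 * m ≤ 3 * R := by
    refine le_of_mul_le_mul_left ?_ hm
    nlinarith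
  nlinarith [mul_pos hq0 hm]

/-- The coefficients of `X ^ 5` and `X ^ 2` in the square of a monic quartic. -/
lemma quartic_sq_coeff (p q r s : ℝ) :
    ((X ^ 4 + C p * X ^ 3 + C q * X ^ 2 + C r * X + C s : ℝ[X]) ^ 2).coeff 5 = 2 * (r + p * q) ∧
    ((X ^ 4 + C p * X ^ 3 + C q * X ^ 2 + C r * X + C s : ℝ[X]) ^ 2).coeff 2
      = r ^ 2 + 2 * q * s := by
  have h : (X ^ 4 + C p * X ^ 3 + C q * X ^ 2 + C r * X + C s : ℝ[X]) ^ 2 =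
      C 1 * X ^ 8 + C (2 * p) * X ^ 7 + C (p ^ 2 + 2 * q) * X ^ 6 + C (2 * (r + p * q)) * X ^ 5
      + C (2 * s + 2 * p * r + q ^ 2) * X ^ 4 + C (2 * p * s + 2 * q * r) * X ^ 3
      + C (r ^ 2 + 2 * q * s) * X ^ 2 + C (2 * r * s) * X ^ 1 + C (s ^ 2) * X ^ 0 := by
    simp only [map_add, map_mul, map_pow, map_ofNat, map_one]
    ring
  rw [h]
  constructor <;> simp only [coeff_add, coeff_C_mul_X_pow] <;> norm_num

/-- No monic degree 8 polynomial of the form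
`(x−ν₁)² (x−ν₂)² (x−ν₃)² (x−δ)²` with `ν₁, ν₂, ν₃ < 0 < δ` defines the sign
pattern (+,+,+,−,−,−,−,+,+). -/
theorem stmt8 (ν₁ ν₂ ν₃ δ : ℝ) (h₁ : ν₁ < 0) (h₂ : ν₂ < 0) (h₃ : ν₃ < 0)
    (hδ : 0 < δ) :
    ¬ definesSignPattern
        ((X - C ν₁) ^ 2 * (X - C ν₂) ^ 2 * (X - C ν₃) ^ 2 * (X - C δ) ^ 2)
        ![1, 1, 1, -1, -1, -1, -1, 1, 1] := by
  intro h
  obtain ⟨a, rfl⟩ : ∃ a, ν₁ = -(a * δ) := ⟨-ν₁ / δ, by field_simp⟩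
  obtain ⟨b, rfl⟩ : ∃ b, ν₂ = -(b * δ) := ⟨-ν₂ / δ, by field_simp⟩
  obtain ⟨c, rfl⟩ : ∃ c, ν₃ = -(c * δ) := ⟨-ν₃ / δ, by field_simp⟩
  have ha : 0 < a := pos_of_mul_pos_left (neg_lt_zero.1 h₁) hδ.le
  have hb : 0 < b := pos_of_mul_pos_left (neg_lt_zero.1 h₂) hδ.le
  have hc : 0 < c := pos_of_mul_pos_left (neg_lt_zero.1 h₃) hδ.le
  have neg_of_sign {x : ℝ} (hx : Real.sign x = -1) : x < 0 := by
    rcases lt_trichotomy x 0 with h | h | h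
    · exact h
    · norm_num [h] at hx
    · norm_num [Real.sign_of_pos h] at hx
  have expand : (X - C (-(a * δ))) ^ 2 * (X - C (-(b * δ))) ^ 2 * (X - C (-(c * δ))) ^ 2
      * (X - C δ) ^ 2 =
      (X ^ 4 + C ((a + b + c - 1) * δ) * X ^ 3
        + C (((a * b + b * c + c * a) - (a + b + c)) * δ ^ 2) * X ^ 2
        + C ((a * b * c - (a * b + b * c + c * a)) * δ ^ 3) * X
        + C (-(a * b * c) * δ ^ 4)) ^ 2 := by
    simp only [map_add, map_sub, map_neg, map_mul, map_pow, map_one]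
    ring
  rw [expand] at h
  have h5 := neg_of_sign (h 3)
  have h2 := neg_of_sign (h 6)
  change coeff _ 5 < 0 at h5
  change coeff _ 2 < 0 at h2
  rw [(quartic_sq_coeff _ _ _ _).1] at h5
  rw [(quartic_sq_coeff _ _ _ _).2] at h2
  refine not_coeff_five_neg_and_coeff_two_neg ha hb hc ?_ ?_
  · refine lt_of_mul_lt_mul_left (a := 2 * δ ^ 3) ?_ (by positivity)
    linear_combination h5
  · refine lt_of_mul_lt_mul_left (a := δ ^ 6) ?_ (by positivity)
    linear_combination h2
end

section
/- Fix a real number α_0 > 1 and define, for real β and γ, the quantities c_5(β,γ) = 2((γ−β)+(α_0−1)(β−α_0)) and c_2(β,γ) = (γ−β)^2 − 2(β−α_0)γ. If α_0 > √3, then the set of pairs (β,γ) with β > 0, γ > 0, c_5(β,γ) = 0 and c_2(β,γ) = 0 consists of exactly the two points I_1 = (α_0, α_0) and I_2 = (α_0(α_0^2−1)/(α_0^2−3), α_0(α_0−1)^2/(α_0^2−3)). If 1 < α_0 ≤ √3, then this set consists of the single point I_1 = (α_0, α_0). -/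
/-- The common zeros of `c₅` and `c₂`, with denominators cleared. -/
theorem c5_c2_eq_zero_iff (a b g : ℝ) :
    (2 * ((g - b) + (a - 1) * (b - a)) = 0 ∧ (g - b) ^ 2 - 2 * (b - a) * g = 0) ↔
      (b = a ∧ g = a) ∨
        (b * (a ^ 2 - 3) = a * (a ^ 2 - 1) ∧ g = b - (a - 1) * (b - a)) := by
  constructor
  · rintro ⟨h5, h2⟩
    have hg : g = b - (a - 1) * (b - a) := by linarith
    have hprod : (b - a) * (b * (a ^ 2 - 3) - a * (a ^ 2 - 1)) = 0 := by
      rw [hg] at h2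
      linear_combination h2
    rcases mul_eq_zero.mp hprod with h | h
    · have hb : b = a := sub_eq_zero.mp h
      exact Or.inl ⟨hb, by rw [hg, hb]; ring⟩
    · exact Or.inr ⟨sub_eq_zero.mp h, hg⟩
  · rintro (⟨rfl, rfl⟩ | ⟨hb, rfl⟩)
    · constructor <;> ring
    · exact ⟨by ring, by linear_combination (b - a) * hb⟩

/-- For fixed `α₀ > 1`, with `c₅(β,γ) = 2((γ−β)+(α₀−1)(β−α₀))` and
`c₂(β,γ) = (γ−β)² − 2(β−α₀)γ`: if `α₀ > √3` the set of `(β,γ)` in the open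
positive quadrant with `c₅ = c₂ = 0` is exactly
`{I₁, I₂}` where `I₁ = (α₀, α₀)` and
`I₂ = (α₀(α₀²−1)/(α₀²−3), α₀(α₀−1)²/(α₀²−3))`;
if `1 < α₀ ≤ √3` this set is exactly `{I₁}`. -/
theorem stmt9 (α₀ : ℝ) (hα : 1 < α₀) :
    (Real.sqrt 3 < α₀ →
      {p : ℝ × ℝ | 0 < p.1 ∧ 0 < p.2 ∧
          2 * ((p.2 - p.1) + (α₀ - 1) * (p.1 - α₀)) = 0 ∧
          (p.2 - p.1) ^ 2 - 2 * (p.1 - α₀) * p.2 = 0} =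
        {(α₀, α₀),
         (α₀ * (α₀ ^ 2 - 1) / (α₀ ^ 2 - 3), α₀ * (α₀ - 1) ^ 2 / (α₀ ^ 2 - 3))}) ∧
    (α₀ ≤ Real.sqrt 3 →
      {p : ℝ × ℝ | 0 < p.1 ∧ 0 < p.2 ∧
          2 * ((p.2 - p.1) + (α₀ - 1) * (p.1 - α₀)) = 0 ∧
          (p.2 - p.1) ^ 2 - 2 * (p.1 - α₀) * p.2 = 0} =
        {(α₀, α₀)}) := by
  have h0 : 0 < α₀ := by linarith
  constructor
  · intro h
    have hD : 0 < α₀ ^ 2 - 3 := sub_pos.mpr ((Real.sqrt_lt' h0).mp h)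
    have h1 : 0 < α₀ - 1 := by linarith
    have h2 : 0 < α₀ ^ 2 - 1 := by linarith
    ext ⟨b, g⟩
    simp only [Set.mem_ofPred_eq, Set.mem_insert_iff, Set.mem_singleton_iff, Prod.mk.injEq,
      c5_c2_eq_zero_iff, eq_div_iff hD.ne']
    constructor
    · rintro ⟨-, -, h | ⟨hb, rfl⟩⟩
      · exact Or.inl h
      · exact Or.inr ⟨hb, by linear_combination (2 - α₀) * hb⟩
    · rintro (⟨rfl, rfl⟩ | ⟨hb, hg⟩)
      · exact ⟨h0, h0, Or.inl ⟨rfl, rfl⟩⟩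
      · refine ⟨pos_of_mul_pos_left (hb ▸ by positivity) hD.le,
          pos_of_mul_pos_left (hg ▸ by positivity) hD.le, Or.inr ⟨hb, ?_⟩⟩
        apply mul_right_cancel₀ hD.ne'
        linear_combination hg - (2 - α₀) * hb
  · intro h
    have hD : α₀ ^ 2 - 3 ≤ 0 := sub_nonpos.mpr ((Real.le_sqrt h0.le (by norm_num)).mp h)
    ext ⟨b, g⟩
    simp only [Set.mem_ofPred_eq, Set.mem_singleton_iff, Prod.mk.injEq, c5_c2_eq_zero_iff]
    constructor
    · rintro ⟨hb0, -, h | ⟨hb, -⟩⟩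
      · exact h
      · have hpos : 0 < α₀ * (α₀ ^ 2 - 1) := mul_pos h0 (by nlinarith)
        have hneg : b * (α₀ ^ 2 - 3) ≤ 0 := mul_nonpos_of_nonneg_of_nonpos hb0.le hD
        linarith
    · rintro ⟨rfl, rfl⟩
      exact ⟨h0, h0, Or.inl ⟨rfl, rfl⟩⟩
end

section
/- For every real α_0 > √3, setting β = α_0(α_0^2−1)/(α_0^2−3) and γ = α_0(α_0−1)^2/(α_0^2−3), one has 4(β − α_0^2/3)^3 + 27(γ + 2α_0^3/27 − α_0 β/3)^2 > 0; consequently, the cubic polynomial x^3 + α_0 x^2 + β x + γ is not hyperbolic, i.e., it has a non-real root. -/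
/-- Up to a positive factor, the negated discriminant of the cubic in `stmt10`. -/
theorem cubic_discriminant_polynomial_pos {a : ℝ} (ha : 17 / 10 < a) :
    0 < 3 * a ^ 6 - 16 * a ^ 5 + 13 * a ^ 4 + 24 * a ^ 3 - 23 * a ^ 2 + 104 * a - 81 := by
  obtain ⟨t, rfl⟩ : ∃ t, a = t + 17 / 10 := ⟨a - 17 / 10, by ring⟩
  have ht : 0 < t := by linarith
  nlinarith [mul_pos ht ht, pow_pos ht 3, sq_nonneg (t * (t - 29 / 20)),
    sq_nonneg (t ^ 2 * (t - 29 / 20)), sq_nonneg (t - 29 / 20),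
    mul_nonneg ht.le (sq_nonneg (t - 29 / 20)),
    mul_nonneg ht.le (sq_nonneg (t * (t - 29 / 20)))]

/-- A real monic cubic with negative discriminant has a non-real root. -/
theorem exists_nonreal_root_of_cubic (a b c : ℝ)
    (h : 0 < 4 * (b - a ^ 2 / 3) ^ 3 + 27 * (c + 2 * a ^ 3 / 27 - a * b / 3) ^ 2) :
    ∃ z : ℂ, z ^ 3 + (a : ℂ) * z ^ 2 + (b : ℂ) * z + (c : ℂ) = 0 ∧ z.im ≠ 0 := by
  obtain ⟨z, hz⟩ := IsAlgClosed.exists_root (Cubic.toPoly ⟨1, (a : ℂ), b, c⟩)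
    (by rw [Cubic.degree_of_a_ne_zero one_ne_zero]; norm_num)
  replace hz : z ^ 3 + (a : ℂ) * z ^ 2 + (b : ℂ) * z + (c : ℂ) = 0 := by
    simpa [Cubic.toPoly] using hz
  by_cases him : z.im = 0
  swap
  · exact ⟨z, hz, him⟩
  obtain ⟨r, rfl⟩ : ∃ r : ℝ, z = r := ⟨z.re, Complex.ext rfl him⟩
  have hr : r ^ 3 + a * r ^ 2 + b * r + c = 0 := by exact_mod_cast hz
  obtain rfl : c = -(r ^ 3 + a * r ^ 2 + b * r) := by linarith
  -- The other two roots are those of `x² + (a + r) x + (r² + a r + b)`.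
  have hd : 0 < 4 * (r ^ 2 + a * r + b) - (a + r) ^ 2 := by
    by_contra! hd
    nlinarith [mul_nonneg (sub_nonneg.mpr hd) (sq_nonneg (3 * r ^ 2 + 2 * a * r + b))]
  set s := Real.sqrt (4 * (r ^ 2 + a * r + b) - (a + r) ^ 2)
  have hs2 : (s : ℂ) ^ 2 = 4 * (r ^ 2 + a * r + b) - (a + r) ^ 2 := by
    exact_mod_cast Real.sq_sqrt hd.le
  have hs0 : 0 < s := Real.sqrt_pos.mpr hd
  refine ⟨(-(a + r) + s * Complex.I) / 2, ?_, ?_⟩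
  · push_cast
    have hI := Complex.I_sq
    linear_combination ((-(a + r) + s * Complex.I) / 2 - r) *
      ((s : ℂ) ^ 2 / 4 * hI - hs2 / 4)
  · have : ((-(a + r) + s * Complex.I) / 2 : ℂ).im = s / 2 := by simp
    rw [this]
    positivity


/-- For `α₀ > √3`, with `β = α₀(α₀²−1)/(α₀²−3)` and `γ = α₀(α₀−1)²/(α₀²−3)`,
one has `4(β − α₀²/3)³ + 27(γ + 2α₀³/27 − α₀β/3)² > 0`; consequently the cubic
`x³ + α₀x² + βx + γ` is not hyperbolic, i.e. it has a non-real root. -/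
theorem stmt10 (α₀ β γ : ℝ) (hα : Real.sqrt 3 < α₀)
    (hβ : β = α₀ * (α₀ ^ 2 - 1) / (α₀ ^ 2 - 3))
    (hγ : γ = α₀ * (α₀ - 1) ^ 2 / (α₀ ^ 2 - 3)) :
    0 < 4 * (β - α₀ ^ 2 / 3) ^ 3 + 27 * (γ + 2 * α₀ ^ 3 / 27 - α₀ * β / 3) ^ 2 ∧
    ∃ z : ℂ, z ^ 3 + (α₀ : ℂ) * z ^ 2 + (β : ℂ) * z + (γ : ℂ) = 0 ∧ z.im ≠ 0 := by
  have h17 : 17 / 10 < α₀ :=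
    (Real.lt_sqrt_of_sq_lt (by norm_num)).trans hα
  have hD : 0 < α₀ ^ 2 - 3 := by
    linarith [(Real.sqrt_lt' (by linarith)).mp hα]
  have hdisc :
      0 < 4 * (β - α₀ ^ 2 / 3) ^ 3 + 27 * (γ + 2 * α₀ ^ 3 / 27 - α₀ * β / 3) ^ 2 := by
    have key : 4 * (β - α₀ ^ 2 / 3) ^ 3 + 27 * (γ + 2 * α₀ ^ 3 / 27 - α₀ * β / 3) ^ 2 =
        α₀ ^ 2 * (α₀ - 1) ^ 2 * (3 * α₀ ^ 6 - 16 * α₀ ^ 5 + 13 * α₀ ^ 4 + 24 * α₀ ^ 3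
          - 23 * α₀ ^ 2 + 104 * α₀ - 81) / (α₀ ^ 2 - 3) ^ 3 := by
      rw [hβ, hγ]
      field_simp
      ring
    have hP := cubic_discriminant_polynomial_pos h17
    have h0 : 0 < α₀ := by linarith
    have h1 : 0 < α₀ - 1 := by linarith
    rw [key]
    positivity
  exact ⟨hdisc, exists_nonreal_root_of_cubic α₀ β γ hdisc⟩
end

section
/- Let W(x) = (x−1)^4 (x^2 + Sx + S^2/4)(x^2 + Mx + N) with real numbers S > 0, M, N satisfying N ≥ M^2/4. If W defines one of the sign patterns (+,−,−,+,−,+,−,+,+), (+,−,−,+,−,+,+,+,+), or (+,−,−,−,−,+,−,+,+), then M > 0. -/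
open Polynomial

theorem pos_of_real_sign_eq_one {x : ℝ} (h : Real.sign x = 1) : 0 < x := by
  rcases lt_trichotomy x 0 with hx | rfl | hx
  · rw [Real.sign_of_neg hx] at h
    norm_num at h
  · simp at h
  · exact hx

theorem neg_of_real_sign_eq_neg_one {x : ℝ} (h : Real.sign x = -1) : x < 0 := by
  rcases lt_trichotomy x 0 with hx | rfl | hx
  · exact hx
  · simp at h
  · rw [Real.sign_of_pos hx] at h
    norm_num at h

theorem sub_one_pow_four_mul_quadratics_eq (S T M N : ℝ) :
    ((X - 1) ^ 4 * (X ^ 2 + C S * X + C T) * (X ^ 2 + C M * X + C N) : ℝ[X]) =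
      C 1 * X ^ 8 + C (S - 4 + M) * X ^ 7 +
      C (T - 4 * S + 6 + M * (S - 4) + N) * X ^ 6 +
      C (-4 * T + 6 * S - 4 + M * (T - 4 * S + 6) + N * (S - 4)) * X ^ 5 +
      C (6 * T - 4 * S + 1 + M * (-4 * T + 6 * S - 4) + N * (T - 4 * S + 6)) * X ^ 4 +
      C (-4 * T + S + M * (6 * T - 4 * S + 1) + N * (-4 * T + 6 * S - 4)) * X ^ 3 +
      C (T + M * (-4 * T + S) + N * (6 * T - 4 * S + 1)) * X ^ 2 +
      C (M * T + N * (-4 * T + S)) * X ^ 1 + C (N * T) * X ^ 0 := by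
  simp only [map_add, map_sub, map_mul, map_neg, map_one, map_ofNat]
  ring

theorem coeff_six_sub_one_pow_four_mul_quadratics (S T M N : ℝ) :
    ((X - 1) ^ 4 * (X ^ 2 + C S * X + C T) * (X ^ 2 + C M * X + C N) : ℝ[X]).coeff 6 =
      T - 4 * S + 6 + M * (S - 4) + N := by
  rw [sub_one_pow_four_mul_quadratics_eq]
  simp only [coeff_add, coeff_C_mul_X_pow]
  norm_num

theorem coeff_one_sub_one_pow_four_mul_quadratics (S T M N : ℝ) :
    ((X - 1) ^ 4 * (X ^ 2 + C S * X + C T) * (X ^ 2 + C M * X + C N) : ℝ[X]).coeff 1 =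
      M * T + N * (-4 * T + S) := by
  rw [sub_one_pow_four_mul_quadratics_eq]
  simp only [coeff_add, coeff_C_mul_X_pow]
  norm_num

theorem pos_of_coeff_six_neg_of_coeff_one_pos {S M N : ℝ} (hS : 0 < S) (hN : M ^ 2 / 4 ≤ N)
    (h₆ : S ^ 2 / 4 - 4 * S + 6 + M * (S - 4) + N < 0)
    (h₁ : 0 < M * (S ^ 2 / 4) + N * (-4 * (S ^ 2 / 4) + S)) : 0 < M := by
  by_contra! hM
  have hN0 : 0 ≤ N := by nlinarith [sq_nonneg M]
  have hS1 : S < 1 := by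
    by_contra! hS1
    have h_M : 0 ≤ -M * (S ^ 2 / 4) := mul_nonneg (by linarith) (by positivity)
    have h_N : 0 ≤ N * (S * (S - 1)) :=
      mul_nonneg hN0 (mul_nonneg hS.le (by linarith))
    linarith
  nlinarith [mul_nonneg (neg_nonneg.2 hM) (by linarith : 0 ≤ 4 - S), sq_nonneg S]

/-- If `W = (x−1)⁴ (x² + Sx + S²/4)(x² + Mx + N)` with `S > 0`, `N ≥ M²/4`
defines one of the sign patterns (+,−,−,+,−,+,−,+,+), (+,−,−,+,−,+,+,+,+) or
(+,−,−,−,−,+,−,+,+), then `M > 0`. -/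
theorem stmt15 (S M N : ℝ) (hS : 0 < S) (hN : M ^ 2 / 4 ≤ N)
    (h : definesSignPattern
          ((X - 1) ^ 4 * (X ^ 2 + C S * X + C (S ^ 2 / 4)) *
            (X ^ 2 + C M * X + C N)) ![1, -1, -1, 1, -1, 1, -1, 1, 1] ∨
         definesSignPattern
          ((X - 1) ^ 4 * (X ^ 2 + C S * X + C (S ^ 2 / 4)) *
            (X ^ 2 + C M * X + C N)) ![1, -1, -1, 1, -1, 1, 1, 1, 1] ∨
         definesSignPattern
          ((X - 1) ^ 4 * (X ^ 2 + C S * X + C (S ^ 2 / 4)) *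
            (X ^ 2 + C M * X + C N)) ![1, -1, -1, -1, -1, 1, -1, 1, 1]) :
    0 < M := by
  suffices h61 : Real.sign (((X - 1) ^ 4 * (X ^ 2 + C S * X + C (S ^ 2 / 4)) *
        (X ^ 2 + C M * X + C N) : ℝ[X]).coeff 6) = -1 ∧
      Real.sign (((X - 1) ^ 4 * (X ^ 2 + C S * X + C (S ^ 2 / 4)) *
        (X ^ 2 + C M * X + C N) : ℝ[X]).coeff 1) = 1 by
    rw [coeff_six_sub_one_pow_four_mul_quadratics,
      coeff_one_sub_one_pow_four_mul_quadratics] at h61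
    exact pos_of_coeff_six_neg_of_coeff_one_pos hS hN
      (neg_of_real_sign_eq_neg_one h61.1) (pos_of_real_sign_eq_one h61.2)
  rcases h with h | h | h <;> exact ⟨h 2, h 7⟩
end

section
/- Let W(x) = (x−1)^4 (x^2 + Sx + S^2/4)(x^2 + Mx + N) with real numbers S, M, N satisfying 0 < S ≤ 3 − √5 and N ≥ M^2/4. Then W does not define any of the sign patterns (+,−,−,+,−,+,−,+,+), (+,−,−,+,−,+,+,+,+), or (+,−,−,−,−,+,−,+,+). -/
open Polynomial

/-- The expansion of `(x-1)⁴ (x² + Sx + T)(x² + Mx + N)`. -/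
theorem X_sub_one_pow_four_mul_quadratics_eq (S T M N : ℝ) :
    (X - 1) ^ 4 * (X ^ 2 + C S * X + C T) * (X ^ 2 + C M * X + C N) =
      X ^ 8 + C (M + (S - 4)) * X ^ 7 + C (N + M * (S - 4) + (6 - 4 * S + T)) * X ^ 6
        + C (N * (S - 4) + M * (6 - 4 * S + T) + (6 * S - 4 - 4 * T)) * X ^ 5
        + C (N * (6 - 4 * S + T) + M * (6 * S - 4 - 4 * T) + (1 - 4 * S + 6 * T)) * X ^ 4
        + C (N * (6 * S - 4 - 4 * T) + M * (1 - 4 * S + 6 * T) + (S - 4 * T)) * X ^ 3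
        + C (N * (1 - 4 * S + 6 * T) + M * (S - 4 * T) + T) * X ^ 2
        + C (N * (S - 4 * T) + M * T) * X + C (N * T) := by
  simp only [map_add, map_sub, map_mul, map_one, map_ofNat]
  ring

/-- The coefficients of `x⁶` and `x³` in `W` cannot be negative and positive respectively:
the former forces `M > 1`, the latter `M < 1`. -/
theorem not_coeff_six_neg_and_coeff_three_pos {S M N : ℝ} (hS : 0 < S)
    (hS' : S ≤ 3 - Real.sqrt 5) (hN : M ^ 2 / 4 ≤ N)
    (h6 : N + M * (S - 4) + (6 - 4 * S + S ^ 2 / 4) < 0)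
    (h3 : 0 < N * (6 * S - 4 - 4 * (S ^ 2 / 4)) + M * (1 - 4 * S + 6 * (S ^ 2 / 4))
      + (S - 4 * (S ^ 2 / 4))) : False := by
  have h5 : (2.236 : ℝ) ≤ Real.sqrt 5 := Real.le_sqrt_of_sq_le (by norm_num)
  have hS1 : S ≤ 0.764 := by linarith
  have hk : 0 ≤ S ^ 2 - 6 * S + 4 := by
    nlinarith [Real.sq_sqrt (show (0 : ℝ) ≤ 5 by norm_num), Real.sqrt_nonneg 5]
  have hM : 1 < M := by
    by_contra! hM
    nlinarith [mul_nonneg (sub_nonneg.2 hM) (show 0 ≤ 3 - S by linarith), sq_nonneg (M - 1)]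
  have hkN := mul_le_mul_of_nonneg_left hN hk
  nlinarith [mul_nonneg hk (sq_nonneg (M - 1)),
    mul_pos (sub_pos.2 hM) (show 0 < 1 + S - S ^ 2 by nlinarith)]

theorem Real.neg_of_sign_eq_neg_one {r : ℝ} (h : Real.sign r = -1) : r < 0 := by
  rcases lt_trichotomy r 0 with hr | rfl | hr
  · exact hr
  · simp at h
  · rw [Real.sign_of_pos hr] at h; norm_num at h

theorem Real.pos_of_sign_eq_one {r : ℝ} (h : Real.sign r = 1) : 0 < r :=
  neg_lt_zero.1 (Real.neg_of_sign_eq_neg_one (by rw [Real.sign_neg, h]))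

theorem not_definesSignPattern_of_two_of_five {S M N : ℝ} (hS : 0 < S)
    (hS' : S ≤ 3 - Real.sqrt 5) (hN : M ^ 2 / 4 ≤ N) {σ : Fin 9 → ℝ}
    (h2 : σ 2 = -1) (h5 : σ 5 = 1) :
    ¬ definesSignPattern
        ((X - 1) ^ 4 * (X ^ 2 + C S * X + C (S ^ 2 / 4)) *
          (X ^ 2 + C M * X + C N)) σ := by
  intro h
  rw [X_sub_one_pow_four_mul_quadratics_eq] at h
  have h6 := Real.neg_of_sign_eq_neg_one ((h 2).trans h2)
  have h3 := Real.pos_of_sign_eq_one ((h 5).trans h5)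
  refine not_coeff_six_neg_and_coeff_three_pos hS hS' hN ?_ ?_
  · simpa only [coeff_add, coeff_C_mul, coeff_X_pow, coeff_X, coeff_C, Fin.reduceFinMk,
      Fin.coe_ofNat_eq_mod, Nat.reduceMod, Nat.reduceSub, Nat.reduceEqDiff, OfNat.one_ne_ofNat,
      OfNat.ofNat_ne_zero, if_true, if_false, mul_one, mul_zero, add_zero, zero_add] using h6
  · simpa only [coeff_add, coeff_C_mul, coeff_X_pow, coeff_X, coeff_C, Fin.reduceFinMk,
      Fin.coe_ofNat_eq_mod, Nat.reduceMod, Nat.reduceSub, Nat.reduceEqDiff, OfNat.one_ne_ofNat,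
      OfNat.ofNat_ne_zero, if_true, if_false, mul_one, mul_zero, add_zero, zero_add] using h3

/-- For `S` in the given range and `N ≥ M²/4`, the polynomial
`W = (x−1)⁴ (x² + Sx + S²/4)(x² + Mx + N)` does not define any of the sign
patterns (+,−,−,+,−,+,−,+,+), (+,−,−,+,−,+,+,+,+), (+,−,−,−,−,+,−,+,+). -/
theorem stmt16 (S M N : ℝ) (hS : 0 < S) (hS' : S ≤ 3 - Real.sqrt 5) (hN : M ^ 2 / 4 ≤ N) :
    ¬ definesSignPattern
        ((X - 1) ^ 4 * (X ^ 2 + C S * X + C (S ^ 2 / 4)) *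
          (X ^ 2 + C M * X + C N)) ![1, -1, -1, 1, -1, 1, -1, 1, 1] ∧
    ¬ definesSignPattern
        ((X - 1) ^ 4 * (X ^ 2 + C S * X + C (S ^ 2 / 4)) *
          (X ^ 2 + C M * X + C N)) ![1, -1, -1, 1, -1, 1, 1, 1, 1] ∧
    ¬ definesSignPattern
        ((X - 1) ^ 4 * (X ^ 2 + C S * X + C (S ^ 2 / 4)) *
          (X ^ 2 + C M * X + C N)) ![1, -1, -1, -1, -1, 1, -1, 1, 1] := by
  refine ⟨?_, ?_, ?_⟩ <;>
    exact not_definesSignPattern_of_two_of_five hS hS' hN rfl rfl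
end
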